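/- Let T be a plane rooted tree and write Q(T) = Σ_{i=0}^{N} a_i q^i with N = deg Q(T). Then a_0 = a_N = 1, a_i > 0 for all 0 ≤ i ≤ N, and Q(T) is palindromic: a_i = a_{N−i} for all 0 ≤ i ≤ N. -/

import Mathlib

/-- A plane rooted tree: a root with an ordered list of plane rooted subtrees. -/
inductive PTree : Type where
  | node : List PTree → PTree

namespace PTree

mutual
/-- Number of edges of a plane rooted tree. -/
def edges : PTree → ℕ
  | .node l => edgesL l
def edgesL : List PTree → ℕ
  | [] => 0
  | t :: ts => (edges t + 1) + edgesL ts
end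

mutual
/-- Number of vertices of a plane rooted tree. -/
def vertices : PTree → ℕ
  | .node l => 1 + verticesL l
def verticesL : List PTree → ℕ
  | [] => 0
  | t :: ts => vertices t + verticesL ts
end

mutual
/-- `plucks T` is the list, indexed by the leaves `v` of `T`, of the pairs
`(r(T,v), T - v)`, where `r(T,v)` is the number of vertices strictly to the
right of the path from `v` to the root, and `T - v` is `T` with the leaf `v`
(and its edge) deleted. -/
def plucks : PTree → List (ℕ × PTree)
  | .node l => (plucksL l).map (fun p => (p.1, PTree.node p.2))
def plucksL : List PTree → List (ℕ × List PTree)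
  | [] => []
  | t :: ts =>
      (match t with
       | .node [] => [(verticesL ts, ts)]
       | .node (s :: ss) =>
          (plucks (.node (s :: ss))).map (fun p => (p.1 + verticesL ts, p.2 :: ts)))
      ++ (plucksL ts).map (fun p => (p.1, t :: p.2))
end

/-- The plucking polynomial, computed with a fuel parameter (the fuel is the
number of edges; each plucking removes exactly one edge). -/
noncomputable def Qfuel : ℕ → PTree → Polynomial ℤ
  | 0, _ => 1
  | (k+1), t =>
      if edges t = 0 then 1
      else ((plucks t).map (fun p => Polynomial.X ^ p.1 * Qfuel k p.2)).sum

/-- The plucking polynomial `Q(T)` of a plane rooted tree: `Q(T) = 1` if `T` has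
no edges, and otherwise `Q(T) = Σ_v q^{r(T,v)} Q(T - v)`, summed over the leaves of `T`. -/
noncomputable def Q (t : PTree) : Polynomial ℤ := Qfuel (edges t) t

end PTree

/-- The `q`-analogue `[a]_q = 1 + q + ⋯ + q^{a-1}`. -/
noncomputable def qInt (a : ℕ) : Polynomial ℤ := (Finset.range a).sum (fun i => Polynomial.X ^ i)

/-- The `q`-factorial `[a]_q! = [1]_q [2]_q ⋯ [a]_q`. -/
noncomputable def qFact : ℕ → Polynomial ℤ
  | 0 => 1
  | (a+1) => qFact a * qInt (a+1)

/-- The `q`-multinomial coefficient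
`(a₁+⋯+a_k choose a₁,…,a_k)_q = [a₁+⋯+a_k]_q! / ([a₁]_q! ⋯ [a_k]_q!)`
(the division, by a monic polynomial, is exact). -/
noncomputable def qMultinomial (l : List ℕ) : Polynomial ℤ :=
  qFact l.sum /ₘ (l.map qFact).prod

/-- The Gaussian binomial coefficient `(a+c choose a)_q`. -/
noncomputable def qBinom (a c : ℕ) : Polynomial ℤ := qMultinomial [a, c]


open Polynomial in
/-- The Gaussian binomial coefficient `(a+c choose a)_q`, defined by the `q`-Pascal recursion. -/
noncomputable def gaussBinom : ℕ → ℕ → ℤ[X]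
  | 0, _ => 1
  | _ + 1, 0 => 1
  | a + 1, c + 1 => X ^ (c + 1) * gaussBinom a (c + 1) + gaussBinom (a + 1) c

theorem gaussBinom_zero_left (c : ℕ) : gaussBinom 0 c = 1 := by
  rw [gaussBinom]

theorem gaussBinom_succ_zero (a : ℕ) : gaussBinom (a + 1) 0 = 1 := by
  rw [gaussBinom]

open Polynomial in
theorem gaussBinom_succ_succ (a c : ℕ) :
    gaussBinom (a + 1) (c + 1) =
      X ^ (c + 1) * gaussBinom a (c + 1) + gaussBinom (a + 1) c := by
  rw [gaussBinom]

open Polynomial in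
/-- The second `q`-Pascal recursion. -/
theorem gaussBinom_succ_succ' (a c : ℕ) :
    gaussBinom (a + 1) (c + 1) =
      gaussBinom a (c + 1) + X ^ (a + 1) * gaussBinom (a + 1) c := by
  induction a generalizing c with
  | zero =>
    induction c with
    | zero => simp [gaussBinom]; ring
    | succ c ih =>
      have h₁ := gaussBinom_succ_succ 0 (c + 1)
      have h₂ := gaussBinom_succ_succ 0 c
      rw [gaussBinom_zero_left] at h₁ h₂ ih ⊢
      linear_combination h₁ + ih - X * h₂
  | succ a iha =>
    induction c with
    | zero =>
      have h₁ := gaussBinom_succ_succ (a + 1) 0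
      have h₂ := gaussBinom_succ_succ a 0
      have h₃ := iha 0
      rw [gaussBinom_succ_zero] at h₁ h₂ h₃ ⊢
      linear_combination h₁ + X * h₃ - h₂
    | succ c ihc =>
      linear_combination gaussBinom_succ_succ (a + 1) (c + 1) + ihc + X ^ (c + 2) * iha (c + 1) -
        gaussBinom_succ_succ a (c + 1) - X ^ (a + 2) * gaussBinom_succ_succ (a + 1) c

namespace Polynomial

/-- A polynomial with constant term `1` that is palindromic of degree `N`, with positive
coefficients up to degree `N`. -/
structure IsPositivePalindrome (N : ℕ) (p : ℤ[X]) : Prop where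
  natDegree_le : p.natDegree ≤ N
  reflect_eq : reflect N p = p
  coeff_zero : p.coeff 0 = 1
  coeff_pos : ∀ i ≤ N, 0 < p.coeff i

namespace IsPositivePalindrome

variable {M N : ℕ} {p r : ℤ[X]}

theorem one : IsPositivePalindrome 0 1 where
  natDegree_le := by simp
  reflect_eq := by simp
  coeff_zero := by simp
  coeff_pos i hi := by simp [Nat.le_zero.mp hi]

theorem coeff_nonneg (hp : IsPositivePalindrome N p) (i : ℕ) : 0 ≤ p.coeff i := by
  rcases le_or_gt i N with h | h
  · exact (hp.coeff_pos i h).le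
  · exact (coeff_eq_zero_of_natDegree_lt (hp.natDegree_le.trans_lt h)).ge

theorem coeff_sub (hp : IsPositivePalindrome N p) {i : ℕ} (hi : i ≤ N) :
    p.coeff (N - i) = p.coeff i := by
  conv_rhs => rw [← hp.reflect_eq, coeff_reflect, revAt_le hi]

theorem natDegree_eq (hp : IsPositivePalindrome N p) : p.natDegree = N :=
  le_antisymm hp.natDegree_le (le_natDegree_of_ne_zero (hp.coeff_pos N le_rfl).ne')

theorem mul (hp : IsPositivePalindrome M p) (hr : IsPositivePalindrome N r) :
    IsPositivePalindrome (M + N) (p * r) where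
  natDegree_le := natDegree_mul_le_of_le hp.natDegree_le hr.natDegree_le
  reflect_eq := by
    rw [reflect_mul p r hp.natDegree_le hr.natDegree_le, hp.reflect_eq, hr.reflect_eq]
  coeff_zero := by rw [mul_coeff_zero, hp.coeff_zero, hr.coeff_zero, one_mul]
  coeff_pos i hi := by
    rw [coeff_mul]
    refine Finset.sum_pos' (fun x _ => mul_nonneg (hp.coeff_nonneg _) (hr.coeff_nonneg _))
      ⟨(min i M, i - min i M), ?_, mul_pos (hp.coeff_pos _ ?_) (hr.coeff_pos _ ?_)⟩
    · rw [Finset.HasAntidiagonal.mem_antidiagonal]; dsimp only; omega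
    · dsimp only; omega
    · dsimp only; omega

end IsPositivePalindrome

end Polynomial

open Polynomial in
theorem isPositivePalindrome_gaussBinom (a c : ℕ) :
    IsPositivePalindrome (a * c) (gaussBinom a c) := by
  induction a generalizing c with
  | zero => simpa [gaussBinom] using IsPositivePalindrome.one
  | succ a iha =>
    induction c with
    | zero => simpa [gaussBinom] using IsPositivePalindrome.one
    | succ c ihc =>
      have hl := iha (c + 1)
      have e₁ : (a + 1) * (c + 1) = (c + 1) + a * (c + 1) := by ring
      have e₂ : (a + 1) * (c + 1) = (a + 1) + (a + 1) * c := by ring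
      refine ⟨?_, ?_, ?_, fun i hi => ?_⟩
      · rw [gaussBinom]
        refine natDegree_add_le_of_degree_le ?_ (ihc.natDegree_le.trans (by omega))
        rw [e₁]
        exact natDegree_mul_le_of_le (natDegree_X_pow_le _) hl.natDegree_le
      · conv_rhs => rw [gaussBinom_succ_succ']
        rw [gaussBinom, reflect_add]
        congr 1
        · rw [e₁, reflect_mul _ _ (natDegree_X_pow_le _) hl.natDegree_le, hl.reflect_eq,
            ← one_mul (X ^ (c + 1)), ← C_1, reflect_C_mul_X_pow]
          simp
        · rw [e₂, ← one_mul (gaussBinom (a + 1) c),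
            reflect_mul _ _ (by simp) ihc.natDegree_le, ihc.reflect_eq]
          simp
      · rw [gaussBinom, coeff_add, ihc.coeff_zero, mul_coeff_zero]
        simp
      · rw [gaussBinom, coeff_add, coeff_X_pow_mul']
        rcases le_or_gt i ((a + 1) * c) with h | h
        · refine add_pos_of_nonneg_of_pos ?_ (ihc.coeff_pos i h)
          split_ifs
          exacts [hl.coeff_nonneg _, le_rfl]
        · have hc : c + 1 ≤ i := by nlinarith
          rw [if_pos hc]
          exact add_pos_of_pos_of_nonneg (hl.coeff_pos _ (by omega)) (ihc.coeff_nonneg _)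

namespace PTree

open Polynomial

mutual
theorem vertices_eq_edges_add_one : ∀ t : PTree, vertices t = edges t + 1
  | .node l => by rw [vertices, edges, verticesL_eq_edgesL l, add_comm]
theorem verticesL_eq_edgesL : ∀ l : List PTree, verticesL l = edgesL l
  | [] => by rw [verticesL, edgesL]
  | t :: ts => by
    rw [verticesL, edgesL, vertices_eq_edges_add_one t, verticesL_eq_edgesL ts]
end

mutual
theorem edges_of_mem_plucks : ∀ (t : PTree), ∀ p ∈ plucks t, edges p.2 + 1 = edges t
  | .node l => by
    intro p hp
    rw [plucks, List.mem_map] at hp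
    obtain ⟨x, hx, rfl⟩ := hp
    simpa only [edges] using edgesL_of_mem_plucksL l x hx
theorem edgesL_of_mem_plucksL :
    ∀ (l : List PTree), ∀ p ∈ plucksL l, edgesL p.2 + 1 = edgesL l
  | [] => by simp [plucksL]
  | .node [] :: ts => by
    intro p hp
    simp only [plucksL, List.mem_append, List.mem_singleton, List.mem_map] at hp
    rcases hp with rfl | ⟨x, hx, rfl⟩
    · simp [edgesL, edges]; omega
    · have := edgesL_of_mem_plucksL ts x hx
      simp only [edgesL]; omega
  | .node (s :: ss) :: ts => by
    intro p hp
    simp only [plucksL, List.mem_append, List.mem_map] at hp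
    rcases hp with ⟨x, hx, rfl⟩ | ⟨x, hx, rfl⟩
    · have := edges_of_mem_plucks (.node (s :: ss)) x hx
      rw [edgesL, edgesL]; omega
    · have := edgesL_of_mem_plucksL ts x hx
      rw [edgesL, edgesL]; omega
end

theorem Q_node_nil : Q (.node []) = 1 := by
  simp [Q, edges, edgesL, Qfuel]

theorem Q_eq_sum {t : PTree} (h : edges t ≠ 0) :
    Q t = ((plucks t).map fun p => X ^ p.1 * Q p.2).sum := by
  obtain ⟨k, hk⟩ := Nat.exists_eq_succ_of_ne_zero h
  rw [Q, hk, Qfuel, if_neg h]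
  congr 1
  refine List.map_congr_left fun p hp => ?_
  have := edges_of_mem_plucks t p hp
  rw [Q, show edges p.2 = k by omega]

theorem Q_node_eq_sum {l : List PTree} (h : edgesL l ≠ 0) :
    Q (.node l) = ((plucksL l).map fun p => X ^ p.1 * Q (.node p.2)).sum := by
  rw [Q_eq_sum (by rwa [edges]), plucks, List.map_map]
  rfl

theorem sum_plucksL_cons (t : PTree) (ts : List PTree)
    (ih : ∀ p ∈ plucksL ts, Q (.node (t :: p.2)) =
      gaussBinom (edges t + 1) (edgesL p.2) * (Q t * Q (.node p.2)))
    (A : ℤ[X]) (hA : A = X ^ edgesL ts * gaussBinom (edges t) (edgesL ts) *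
      (Q t * Q (.node ts))) :
    A + ((plucksL ts).map fun p => X ^ p.1 * Q (.node (t :: p.2))).sum =
      gaussBinom (edges t + 1) (edgesL ts) * (Q t * Q (.node ts)) := by
  rcases ts with _ | ⟨s, ss⟩
  · rw [hA]
    cases edges t <;> simp [plucksL, edgesL, gaussBinom]
  · obtain ⟨c, hc⟩ : ∃ c, edgesL (s :: ss) = c + 1 := ⟨edges s + edgesL ss, by rw [edgesL]; ring⟩
    have hsum : ((plucksL (s :: ss)).map fun p => X ^ p.1 * Q (.node (t :: p.2))).sum =
        gaussBinom (edges t + 1) c * Q t * Q (.node (s :: ss)) := by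
      rw [Q_node_eq_sum (l := s :: ss) (by omega), ← List.sum_map_mul_left]
      congr 1
      refine List.map_congr_left fun p hp => ?_
      have := edgesL_of_mem_plucksL _ p hp
      rw [ih p hp, show edgesL p.2 = c by omega]
      ring
    rw [hsum, hA, hc, gaussBinom]
    ring

/-- The plucking polynomial of a tree, in terms of its leftmost branch and the rest. -/
theorem Q_node_cons (t : PTree) (ts : List PTree) :
    Q (.node (t :: ts)) =
      gaussBinom (edges t + 1) (edgesL ts) * (Q t * Q (.node ts)) := by
  induction hn : edges t + edgesL ts using Nat.strong_induction_on generalizing t ts with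
  | _ n ih =>
    have ih_right : ∀ p ∈ plucksL ts, Q (.node (t :: p.2)) =
        gaussBinom (edges t + 1) (edgesL p.2) * (Q t * Q (.node p.2)) := fun p hp => by
      have := edgesL_of_mem_plucksL ts p hp
      exact ih _ (by omega) t p.2 rfl
    rw [← sum_plucksL_cons t ts ih_right _ rfl, Q_node_eq_sum (by rw [edgesL]; omega)]
    rcases t with ⟨_ | ⟨s, ss⟩⟩
    · simp [plucksL, Q_node_nil, edges, edgesL, gaussBinom, verticesL_eq_edgesL,
        Function.comp_def]
    · rw [plucksL, List.map_append, List.sum_append, List.map_map, List.map_map]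
      congr 1
      have h0 : edges (.node (s :: ss)) ≠ 0 := by rw [edges, edgesL]; omega
      rw [mul_comm (Q _) (Q _), ← mul_assoc, Q_eq_sum h0, ← List.sum_map_mul_left]
      congr 1
      refine List.map_congr_left fun p hp => ?_
      have := edges_of_mem_plucks _ p hp
      simp only [Function.comp_apply]
      rw [ih _ (by omega) p.2 ts rfl, this, verticesL_eq_edgesL]
      ring

theorem exists_isPositivePalindrome_Q (t : PTree) : ∃ N, IsPositivePalindrome N (Q t) := by
  induction hn : edges t using Nat.strong_induction_on generalizing t with
  | _ n ih =>
    rcases t with ⟨_ | ⟨s, ss⟩⟩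
    · exact ⟨0, Q_node_nil ▸ IsPositivePalindrome.one⟩
    · rw [edges, edgesL] at hn
      obtain ⟨M, hM⟩ := ih _ (by omega) s rfl
      obtain ⟨N, hN⟩ := ih (edgesL ss) (by omega) (.node ss) (by rw [edges])
      exact ⟨_, Q_node_cons s ss ▸ (isPositivePalindrome_gaussBinom _ _).mul (hM.mul hN)⟩

end PTree

/-- Writing `Q(T) = Σ_{i=0}^{N} aᵢ qⁱ` with `N = deg Q(T)`, one has `a₀ = a_N = 1`,
`aᵢ > 0` for all `0 ≤ i ≤ N`, and `Q(T)` is palindromic: `aᵢ = a_{N-i}`. -/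
theorem plucking_coeffs (t : PTree) (N : ℕ) (hN : N = (PTree.Q t).natDegree) :
    (PTree.Q t).coeff 0 = 1 ∧ (PTree.Q t).coeff N = 1 ∧
    (∀ i ≤ N, 0 < (PTree.Q t).coeff i) ∧
    (∀ i ≤ N, (PTree.Q t).coeff i = (PTree.Q t).coeff (N - i)) := by
  obtain ⟨M, hM⟩ := PTree.exists_isPositivePalindrome_Q t
  obtain rfl : N = M := hN.trans hM.natDegree_eq
  refine ⟨hM.coeff_zero, ?_, hM.coeff_pos, fun i hi => (hM.coeff_sub hi).symm⟩
  simpa [hM.coeff_zero] using hM.coeff_sub (Nat.zero_le N)
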